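/- In the algebra Uı, for all integers t ≥ 0 and l ≥ 0, the following identity holds: (B₂^{(t)} B₁^{(l+t)} B₂^{(l)}) · B₂ = [l+1] · ( B₁^{(l)} B₂^{(l+t+1)} B₁^{(t)} + B₁^{(l+1)} B₂^{(l+t+1)} B₁^{(t−1)} − {k₁; l − t − 1/2} · B₁^{(l)} B₂^{(l+t)} B₁^{(t−1)} ), where divided powers with negative superscript are zero. -/

import Mathlib

noncomputable section

namespace UiAIII

/-- The base field `K = ℚ(t)`, where `q := t²`. -/
abbrev K : Type := RatFunc ℚ

/-- `t^s` for `s : ℤ`; so `tz (2*n)` represents `q^n` and `tz s` represents `q^{s/2}`. -/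
def tz (s : ℤ) : K := (RatFunc.X : K) ^ s

/-- The quantum integer `[n] = (q^n - q^{-n})/(q - q^{-1})`, with `q = t²`. -/
def qint (n : ℤ) : K := (tz (2 * n) - tz (-(2 * n))) / (tz 2 - tz (-2))

/-- The quantum factorial `[n]!`. -/
def qfact (n : ℕ) : K := ∏ i ∈ Finset.range n, qint ((i : ℤ) + 1)

variable {A : Type*} [Ring A] [Algebra K A]

/-- Divided power `x^{(m)} = x^m/[m]!` for `m ≥ 0`, and `0` for `m < 0`. -/
def dp (x : A) (m : ℤ) : A := if 0 ≤ m then (qfact m.toNat)⁻¹ • x ^ m.toNat else 0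

/-- `{k; s/2} := q^{s/2}·k + q^{-s/2}·k⁻¹`; the argument `s` is twice the half-integer. -/
def brace (k kinv : A) (s : ℤ) : A := tz s • k + tz (-s) • kinv

/-- `k^j` for `j : ℤ`, using the two-sided inverse `kinv` of `k`. -/
def upow (k kinv : A) (j : ℤ) : A := if 0 ≤ j then k ^ j.toNat else kinv ^ (-j).toNat

end UiAIII

open UiAIII

namespace UiAIII

theorem tz_add (a b : ℤ) : tz (a + b) = tz a * tz b :=
  zpow_add₀ RatFunc.X_ne_zero a b

theorem tz_neg (a : ℤ) : tz (-a) = (tz a)⁻¹ := zpow_neg _ a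

theorem tz_zero : tz 0 = 1 := zpow_zero _

theorem tz_ne_zero (a : ℤ) : tz a ≠ 0 := zpow_ne_zero a RatFunc.X_ne_zero

theorem tz_natCast_ne_one {n : ℕ} (hn : n ≠ 0) : tz n ≠ 1 := by
  intro h
  rw [tz, zpow_natCast, ← RatFunc.algebraMap_X, ← map_pow,
    ← map_one (algebraMap (Polynomial ℚ) (RatFunc ℚ))] at h
  have h2 := congrArg Polynomial.natDegree (RatFunc.algebraMap_injective ℚ h)
  simp only [Polynomial.natDegree_X_pow, Polynomial.natDegree_one] at h2
  exact hn h2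

theorem tz_sub_tz_neg_ne_zero {n : ℕ} (hn : n ≠ 0) : tz n - tz (-n) ≠ 0 := by
  intro h
  apply tz_natCast_ne_one (n := n + n) (by omega)
  rw [Nat.cast_add, tz_add]
  nth_rewrite 1 [sub_eq_zero.mp h]
  rw [← tz_add, neg_add_cancel, tz_zero]

theorem tz_two_sub_ne_zero : tz 2 - tz (-2) ≠ 0 :=
  mod_cast tz_sub_tz_neg_ne_zero (n := 2) two_ne_zero

theorem qint_natCast_add_one_ne_zero (n : ℕ) : qint ((n : ℤ) + 1) ≠ 0 := by
  refine div_ne_zero ?_ tz_two_sub_ne_zero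
  have h := tz_sub_tz_neg_ne_zero (n := 2 * (n + 1)) (by omega)
  push_cast at h
  exact h

theorem qfact_ne_zero (n : ℕ) : qfact n ≠ 0 :=
  Finset.prod_ne_zero_iff.mpr fun i _ => qint_natCast_add_one_ne_zero i

theorem qfact_succ (n : ℕ) : qfact (n + 1) = qfact n * qint ((n : ℤ) + 1) :=
  Finset.prod_range_succ _ n

theorem qint_zero : qint 0 = 0 := by simp [qint]

theorem qint_one : qint 1 = 1 := div_self tz_two_sub_ne_zero

/-- `[x+z][y+z] = [x][y] + [z][x+y+z]`. -/
theorem qint_add_mul_qint_add (x y z : ℤ) :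
    qint (x + z) * qint (y + z) = qint x * qint y + qint z * qint (x + y + z) := by
  have := tz_ne_zero (2 * x)
  have := tz_ne_zero (2 * y)
  have := tz_ne_zero (2 * z)
  simp only [qint, mul_add, neg_add, tz_add, div_eq_mul_inv]
  generalize (tz 2 - tz (-2))⁻¹ = d
  simp only [tz_neg]
  field_simp
  ring

/-- `[x+1][2] = [x+2] + [x]`. -/
theorem qint_add_one_mul_qint_two (x : ℤ) :
    qint (x + 1) * qint 2 = qint (x + 2) + qint x := by
  have h := qint_add_mul_qint_add 1 x 1
  rw [show (1 + 1 : ℤ) = 2 from rfl, show (1 + x + 1 : ℤ) = x + 2 by ring, qint_one] at h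
  linear_combination h

/-- `[x+1]² = [x][x+2] + 1`. -/
theorem qint_add_one_sq (x : ℤ) : qint (x + 1) ^ 2 = qint x * qint (x + 2) + 1 := by
  have h := qint_add_mul_qint_add 1 1 x
  rw [show (1 + 1 + x : ℤ) = x + 2 by ring, add_comm 1 x, qint_one] at h
  linear_combination h

/-- `q^y[x] + q^{-x}[y] = [x+y]`. -/
theorem tz_mul_qint_add (x y : ℤ) :
    tz (2 * y) * qint x + tz (-(2 * x)) * qint y = qint (x + y) := by
  simp only [qint, mul_add, neg_add, tz_add]
  ring

/-- `q^{-y}[x] + q^x[y] = [x+y]`. -/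
theorem tz_neg_mul_qint_add (x y : ℤ) :
    tz (-(2 * y)) * qint x + tz (2 * x) * qint y = qint (x + y) := by
  simp only [qint, mul_add, neg_add, tz_add]
  ring

variable {A : Type*} [Ring A] [Algebra K A]

theorem dp_natCast (x : A) (n : ℕ) : dp x (n : ℤ) = (qfact n)⁻¹ • x ^ n := by
  simp [dp]

theorem mul_inv_of_mul {a k k' : A} {s : ℤ} (hk : k * k' = 1) (hk' : k' * k = 1)
    (h : k * a = tz s • (a * k)) : k' * a = tz (-s) • (a * k') := by
  have h2 : a * k' = tz s • (k' * a) := by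
    have h3 : k' * (k * a) * k' = a * k' := by rw [← mul_assoc, hk', one_mul]
    rw [← h3, h, mul_smul_comm, smul_mul_assoc, mul_assoc, mul_assoc, hk, mul_one]
  rw [h2, smul_smul, ← tz_add, neg_add_cancel, tz_zero, one_smul]

theorem mul_eq_of_mul {a k : A} {s : ℤ}
    (h : k * a = tz s • (a * k)) : a * k = tz (-s) • (k * a) := by
  rw [h, smul_smul, ← tz_add, neg_add_cancel, tz_zero, one_smul]

theorem pow_mul_of_mul {a k : A} {s : ℤ} (h : a * k = tz s • (k * a)) (n : ℕ) :
    a ^ n * k = tz (n * s) • (k * a ^ n) := by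
  induction n with
  | zero => simp [tz_zero]
  | succ n ih =>
    rw [pow_succ', mul_assoc, ih, mul_smul_comm, ← mul_assoc, h, smul_mul_assoc, smul_smul,
      ← tz_add, mul_assoc]
    push_cast
    ring_nf

theorem pow_mul_brace {a k k' : A} {s : ℤ} (h : a * k = tz s • (k * a))
    (h' : a * k' = tz (-s) • (k' * a)) (n : ℕ) (c : ℤ) :
    a ^ n * brace k k' c = brace k k' (c + n * s) * a ^ n := by
  simp only [brace, mul_add, add_mul, mul_smul_comm, smul_mul_assoc, pow_mul_of_mul h,
    pow_mul_of_mul h', smul_smul, ← tz_add]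
  ring_nf

/-- Shadows `RatFunc.instAlgebraOfPolynomial`, whose `ℕ`-action `module` does not recognize. -/
local instance natAlgebra : Algebra ℕ K := Semiring.toNatAlgebra

/-- Shadows `RatFunc.instAlgebraOfPolynomial`, whose `ℤ`-action `module` does not recognize. -/
local instance intAlgebra : Algebra ℤ K := Ring.toIntAlgebra K

/-- Straightening of `aⁿ⁺¹b` under the deformed Serre relation. -/
theorem pow_succ_mul_of_serre {a b k k' : A}
    (h : a * k = tz 6 • (k * a)) (h' : a * k' = tz (-6) • (k' * a))
    (hS : a ^ 2 * b - qint 2 • (a * b * a) + b * a ^ 2 = qint 2 • (brace k k' 3 * a))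
    (n : ℕ) :
    a ^ (n + 1) * b = qint ((n : ℤ) + 1) • (a * b * a ^ n) - qint n • (b * a ^ (n + 1))
      + (qint n * qint ((n : ℤ) + 1)) • (brace k k' (2 * n + 1) * a ^ n) := by
  induction n with
  | zero => simp [qint_zero, qint_one]
  | succ n ih =>
    have hS' : a * (a * b) = qint 2 • (a * b * a) - b * (a * a) + qint 2 • (brace k k' 3 * a) := by
      rw [← hS]; noncomm_ring
    have hb := pow_mul_brace h h' 1 (2 * n + 1)
    rw [pow_one] at hb
    have l : a ^ (n + 1 + 1) * b = a * (a ^ (n + 1) * b) := by rw [pow_succ', mul_assoc]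
    have r : a * (a * b * a ^ n) = a * (a * b) * a ^ n := by noncomm_ring
    have r2 : a * (b * a ^ (n + 1)) = a * b * a ^ (n + 1) := by noncomm_ring
    have r3 : a * (brace k k' (2 * n + 1) * a ^ n) = brace k k' (2 * n + 7) * a ^ (n + 1) := by
      rw [← mul_assoc, hb, mul_assoc, ← pow_succ', Nat.cast_one, one_mul, add_assoc]
      rfl
    have r4 : a * b * a * a ^ n = a * b * a ^ (n + 1) := by rw [mul_assoc, ← pow_succ']
    have r5 : b * (a * a) * a ^ n = b * a ^ (n + 2) := by
      rw [mul_assoc, ← pow_two, ← pow_add, add_comm]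
    have r6 : brace k k' 3 * a * a ^ n = brace k k' 3 * a ^ (n + 1) := by
      rw [mul_assoc, ← pow_succ']
    rw [l, ih, mul_add, mul_sub, mul_smul_comm, mul_smul_comm, mul_smul_comm, r, hS', r2, r3]
    simp only [add_mul, sub_mul, smul_mul_assoc, r4, r5, r6]
    simp only [brace, add_mul, smul_mul_assoc]
    have e1 := qint_add_one_mul_qint_two n
    have e4 : tz (2 * n + 7) * qint n + tz 3 * qint 2 = tz (2 * n + 3) * qint (n + 2) := by
      rw [← tz_mul_qint_add, mul_add, ← mul_assoc, ← mul_assoc, ← tz_add, ← tz_add]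
      ring_nf
    have e5 : tz (-(2 * n + 7)) * qint n + tz (-3) * qint 2
        = tz (-(2 * n + 3)) * qint (n + 2) := by
      rw [← tz_neg_mul_qint_add, mul_add, ← mul_assoc, ← mul_assoc, ← tz_add, ← tz_add]
      ring_nf
    push_cast
    rw [show (n : ℤ) + 1 + 1 = n + 2 by ring, show 2 * ((n : ℤ) + 1) + 1 = 2 * n + 3 by ring]
    match_scalars
    · linear_combination e1
    · ring
    · linear_combination qint (n + 1) * e4
    · linear_combination qint (n + 1) * e5

/-- The deformed Serre relation for `(a, b)` straightens `bᵐab`. -/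
theorem pow_mul_mul_of_serre {a b k k' : A}
    (h : a * k = tz 6 • (k * a)) (h' : a * k' = tz (-6) • (k' * a))
    (hS : a ^ 2 * b - qint 2 • (a * b * a) + b * a ^ 2 = qint 2 • (brace k k' 3 * a))
    (m : ℕ) :
    qint ((m : ℤ) + 1) • (a ^ m * b * a) = qint m • (a ^ (m + 1) * b) + b * a ^ (m + 1)
      - (qint m * qint ((m : ℤ) + 1)) • (brace k' k (1 - 4 * m) * a ^ m) := by
  cases m with
  | zero => simp [qint_zero, qint_one]
  | succ m =>
    have h1 := pow_succ_mul_of_serre h h' hS m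
    have h2 := pow_succ_mul_of_serre h h' hS (m + 1)
    have r1 : a * b * a ^ m * a = a * b * a ^ (m + 1) := by rw [mul_assoc, ← pow_succ]
    have r2 : b * a ^ (m + 1) * a = b * a ^ (m + 1 + 1) := by rw [mul_assoc, ← pow_succ]
    have r3 (x : A) : x * a ^ m * a = x * a ^ (m + 1) := by rw [mul_assoc, ← pow_succ]
    have e := qint_add_one_sq m
    have e4 : tz (2 * m + 1) * qint m - tz (2 * m + 3) * qint (m + 1) = - tz (4 * m + 3) := by
      rw [← tz_neg_mul_qint_add m 1, qint_one, mul_add, ← mul_assoc, mul_one, mul_one,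
        ← tz_add, ← tz_add]
      ring_nf
    have e5 : tz (-(2 * m + 1)) * qint m - tz (-(2 * m + 3)) * qint (m + 1)
        = - tz (-(4 * m + 3)) := by
      rw [← tz_mul_qint_add m 1, qint_one, mul_add, ← mul_assoc, mul_one, mul_one,
        ← tz_add, ← tz_add]
      ring_nf
    rw [h2, h1]
    simp only [add_mul, sub_mul, smul_mul_assoc, r1, r2, r3]
    simp only [brace, add_mul, smul_mul_assoc]
    push_cast
    rw [show (m : ℤ) + 1 + 1 = m + 2 by ring, show 2 * ((m : ℤ) + 1) + 1 = 2 * m + 3 by ring,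
      show 1 - 4 * ((m : ℤ) + 1) = - (4 * m + 3) by ring, neg_neg]
    match_scalars
    · ring
    · linear_combination e
    · linear_combination qint (m + 1) * qint (m + 2) * e4
    · linear_combination qint (m + 1) * qint (m + 2) * e5

/-- The subalgebra generated by the weight zero elements `ba`, `ab`, `k` and `k'`. -/
abbrev weightZero (a b k k' : A) : Subalgebra K A := Algebra.adjoin K {b * a, a * b, k, k'}

/-- If `x` can be moved past generators of a subalgebra, it can be moved past all of it. -/
theorem exists_mul_eq_mul_of_mem_adjoin {s : Set A} {x : A}
    (hs : ∀ r ∈ s, ∃ r' ∈ Algebra.adjoin K s, x * r = r' * x) {r : A}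
    (hr : r ∈ Algebra.adjoin K s) : ∃ r' ∈ Algebra.adjoin K s, x * r = r' * x := by
  induction hr using Algebra.adjoin_induction with
  | mem r hr => exact hs r hr
  | algebraMap c => exact ⟨_, Subalgebra.algebraMap_mem _ c, (Algebra.commutes c x).symm⟩
  | add y z _ _ hy hz =>
    obtain ⟨y', hy, ey⟩ := hy
    obtain ⟨z', hz, ez⟩ := hz
    exact ⟨y' + z', add_mem hy hz, by rw [mul_add, ey, ez, add_mul]⟩
  | mul y z _ _ hy hz =>
    obtain ⟨y', hy, ey⟩ := hy
    obtain ⟨z', hz, ez⟩ := hz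
    exact ⟨y' * z', mul_mem hy hz, by rw [← mul_assoc, ey, mul_assoc, ez, mul_assoc]⟩

theorem exists_mul_eq_mul_of_mem_weightZero {a b k k' : A}
    (h : a * k = tz 6 • (k * a)) (h' : a * k' = tz (-6) • (k' * a))
    (hS : a ^ 2 * b - qint 2 • (a * b * a) + b * a ^ 2 = qint 2 • (brace k k' 3 * a))
    {r : A} (hr : r ∈ weightZero a b k k') : ∃ r' ∈ weightZero a b k k', a * r = r' * a := by
  have hu : b * a ∈ weightZero a b k k' := Algebra.subset_adjoin (by simp)
  have hv : a * b ∈ weightZero a b k k' := Algebra.subset_adjoin (by simp)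
  have hk : k ∈ weightZero a b k k' := Algebra.subset_adjoin (by simp)
  have hk' : k' ∈ weightZero a b k k' := Algebra.subset_adjoin (by simp)
  refine exists_mul_eq_mul_of_mem_adjoin (fun r hr => ?_) hr
  rcases hr with rfl | rfl | rfl | rfl
  · exact ⟨_, hv, (mul_assoc _ _ _).symm⟩
  · refine ⟨qint 2 • (a * b) - b * a + qint 2 • brace k k' 3, ?_, ?_⟩
    · exact add_mem (sub_mem (Subalgebra.smul_mem _ hv _) hu) (Subalgebra.smul_mem _
        (add_mem (Subalgebra.smul_mem _ hk _) (Subalgebra.smul_mem _ hk' _)) _)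
    · rw [add_mul, smul_mul_assoc _ (brace _ _ _), ← hS, sub_mul, smul_mul_assoc]
      noncomm_ring
  · exact ⟨_, Subalgebra.smul_mem _ hk (tz 6), by rw [h, smul_mul_assoc]⟩
  · exact ⟨_, Subalgebra.smul_mem _ hk' (tz (-6)), by rw [h', smul_mul_assoc]⟩

theorem weightZero_swap (a b k k' : A) : weightZero b a k' k = weightZero a b k k' := by
  rw [weightZero, Set.insert_comm, Set.pair_comm]

theorem mul_mul_mem_weightZero {a b k k' : A}
    (h : a * k = tz 6 • (k * a)) (h' : a * k' = tz (-6) • (k' * a))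
    (hS : a ^ 2 * b - qint 2 • (a * b * a) + b * a ^ 2 = qint 2 • (brace k k' 3 * a))
    (n : ℕ) : a ^ n * b ^ n ∈ weightZero a b k k' := by
  induction n with
  | zero => simp
  | succ n ih =>
    obtain ⟨r, hr, e⟩ := exists_mul_eq_mul_of_mem_weightZero h h' hS ih
    have : a ^ (n + 1) * b ^ (n + 1) = r * (a * b) := by
      rw [← mul_assoc, ← e, pow_succ', pow_succ]
      simp only [mul_assoc]
    rw [this]
    exact mul_mem hr (Algebra.subset_adjoin (by simp))

/-- The deformed Serre relations make `ba` and `ab` commute. -/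
theorem commute_mul_mul_of_serre {a b k k' : A}
    (g : b * k = tz (-6) • (k * b)) (g' : b * k' = tz 6 • (k' * b))
    (hS : a ^ 2 * b - qint 2 • (a * b * a) + b * a ^ 2 = qint 2 • (brace k k' 3 * a))
    (hT : b ^ 2 * a - qint 2 • (b * a * b) + a * b ^ 2 = qint 2 • (brace k' k 3 * b)) :
    Commute (b * a) (a * b) := by
  have e : b * brace k k' 3 = brace k' k 3 * b := by
    simp only [brace, mul_add, add_mul, mul_smul_comm, smul_mul_assoc, g, g', smul_smul, ← tz_add]
    exact add_comm _ _
  have h1 := congrArg (b * ·) hS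
  have h2 := congrArg (· * a) hT
  have h3 : b * (qint 2 • (brace k k' 3 * a)) = qint 2 • (brace k' k 3 * b) * a := by
    rw [mul_smul_comm, smul_mul_assoc, ← mul_assoc, e]
  have h4 := h1.trans (h3.trans h2.symm)
  simp only [mul_add, mul_sub, add_mul, sub_mul, mul_smul_comm, smul_mul_assoc, pow_two,
    ← mul_assoc] at h4
  rw [Commute, SemiconjBy, ← mul_assoc, ← mul_assoc, ← sub_eq_zero]
  rw [← sub_eq_zero] at h4
  rw [← h4]
  abel

theorem commute_of_mem_weightZero {a b k k' : A} (hk : Commute k k')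
    (h : a * k = tz 6 • (k * a)) (h' : a * k' = tz (-6) • (k' * a))
    (g : b * k = tz (-6) • (k * b)) (g' : b * k' = tz 6 • (k' * b))
    (hS : a ^ 2 * b - qint 2 • (a * b * a) + b * a ^ 2 = qint 2 • (brace k k' 3 * a))
    (hT : b ^ 2 * a - qint 2 • (b * a * b) + a * b ^ 2 = qint 2 • (brace k' k 3 * b))
    {x y : A} (hx : x ∈ weightZero a b k k') (hy : y ∈ weightZero a b k k') :
    Commute x y := by
  have huv := commute_mul_mul_of_serre g g' hS hT
  have aux {c d l : A} {s : ℤ} (hc : c * l = tz s • (l * c)) (hd : d * l = tz (-s) • (l * d)) :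
      Commute (c * d) l := by
    rw [Commute, SemiconjBy, mul_assoc, hd, mul_smul_comm, ← mul_assoc, hc, smul_mul_assoc,
      smul_smul, ← tz_add, neg_add_cancel, tz_zero, one_smul, mul_assoc]
  have hvk := aux h g
  have huk := aux g (neg_neg (6 : ℤ) ▸ h)
  have hvk' := aux h' (neg_neg (6 : ℤ) ▸ g')
  have huk' := aux g' h'
  refine Algebra.commute_of_mem_adjoin_of_forall_mem_commute hy fun p hp =>
    (Algebra.commute_of_mem_adjoin_of_forall_mem_commute hx fun r hr => ?_).symm
  rcases hp with rfl | rfl | rfl | rfl <;> rcases hr with rfl | rfl | rfl | rfl <;>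
    first
    | exact Commute.refl _
    | assumption
    | (apply Commute.symm; assumption)

/-- The divided-power-free form of the identity of Lusztig type in weight zero. -/
theorem pow_mul_pow_mul_pow {a b k k' : A} (hk : Commute k k')
    (h : a * k = tz 6 • (k * a)) (h' : a * k' = tz (-6) • (k' * a))
    (g : b * k = tz (-6) • (k * b)) (g' : b * k' = tz 6 • (k' * b))
    (hS : a ^ 2 * b - qint 2 • (a * b * a) + b * a ^ 2 = qint 2 • (brace k k' 3 * a))
    (hT : b ^ 2 * a - qint 2 • (b * a * b) + a * b ^ 2 = qint 2 • (brace k' k 3 * b))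
    (t l : ℕ) : b ^ t * a ^ (l + t) * b ^ l = a ^ l * b ^ (l + t) * a ^ t := by
  have hx := mul_mul_mem_weightZero g' g hT t
  rw [weightZero_swap] at hx
  have hc := commute_of_mem_weightZero hk h h' g g' hS hT hx (mul_mul_mem_weightZero h h' hS l)
  rw [add_comm l t, pow_add, add_comm t l, pow_add]
  simpa only [mul_assoc] using hc.eq

/-- The identity without divided powers. -/
theorem pow_mul_pow_mul_pow_mul {a b k k' : A} (hk : Commute k k')
    (h : a * k = tz 6 • (k * a)) (h' : a * k' = tz (-6) • (k' * a))
    (g : b * k = tz (-6) • (k * b)) (g' : b * k' = tz 6 • (k' * b))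
    (hS : a ^ 2 * b - qint 2 • (a * b * a) + b * a ^ 2 = qint 2 • (brace k k' 3 * a))
    (hT : b ^ 2 * a - qint 2 • (b * a * b) + a * b ^ 2 = qint 2 • (brace k' k 3 * b))
    (n l : ℕ) :
    qint ((l : ℤ) + n + 2) • (b ^ (n + 1) * a ^ (l + n + 1) * b ^ l * b)
      = qint ((l : ℤ) + 1) • (a ^ l * b ^ (l + n + 2) * a ^ (n + 1))
        + qint ((n : ℤ) + 1) • (a ^ (l + 1) * b ^ (l + n + 2) * a ^ n)
        - (qint ((l : ℤ) + 1) * qint ((n : ℤ) + 1) * qint ((l : ℤ) + n + 2)) •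
          (brace k k' (2 * l - 2 * n - 3) * (a ^ l * b ^ (l + n + 1) * a ^ n)) := by
  have hA := pow_succ_mul_of_serre h h' hS n
  have hB := pow_mul_mul_of_serre g' g hT (l + n + 1)
  have hL := pow_mul_pow_mul_pow hk h h' g g' hS hT (n + 1) l
  rw [← add_assoc] at hL
  have hbr (c : ℤ) : b ^ (l + n + 1) * brace k k' c
      = brace k k' (c - 6 * (l + n + 1)) * b ^ (l + n + 1) := by
    rw [pow_mul_brace g g']; congr 2; push_cast; ring
  have hbl (c : ℤ) : a ^ l * brace k k' c = brace k k' (c + 6 * l) * a ^ l := by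
    rw [pow_mul_brace h h']; congr 2; ring
  have r1 : a ^ l * b ^ (l + n + 1) * (a * b * a ^ n)
      = a ^ l * (b ^ (l + n + 1) * a * b) * a ^ n := by simp only [mul_assoc]
  have r2 : a ^ l * b ^ (l + n + 1) * (b * a ^ (n + 1))
      = a ^ l * b ^ (l + n + 2) * a ^ (n + 1) := by
    rw [pow_succ b (l + n + 1)]; simp only [mul_assoc]
  have r3 (c : ℤ) : a ^ l * b ^ (l + n + 1) * (brace k k' c * a ^ n)
      = brace k k' (c - 6 * n - 6) * (a ^ l * b ^ (l + n + 1) * a ^ n) := by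
    rw [mul_assoc (a ^ l), ← mul_assoc (b ^ _), hbr, ← mul_assoc, ← mul_assoc, hbl]
    simp only [mul_assoc]; congr 2; ring
  have r4 : a ^ l * (b ^ (l + n + 1 + 1) * a) * a ^ n
      = a ^ l * b ^ (l + n + 2) * a ^ (n + 1) := by
    rw [pow_succ' a n]; simp only [mul_assoc]
  have r5 : a ^ l * (a * b ^ (l + n + 1 + 1)) * a ^ n
      = a ^ (l + 1) * b ^ (l + n + 2) * a ^ n := by
    rw [pow_succ a l]; simp only [mul_assoc]
  have r6 (c : ℤ) : a ^ l * (brace k k' c * b ^ (l + n + 1)) * a ^ n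
      = brace k k' (c + 6 * l) * (a ^ l * b ^ (l + n + 1) * a ^ n) := by
    rw [← mul_assoc (a ^ l), hbl]; simp only [mul_assoc]
  have hX : qint ((l : ℤ) + n + 2) • (a ^ l * (b ^ (l + n + 1) * a * b) * a ^ n)
      = a ^ l * (qint ((l : ℤ) + n + 2) • (b ^ (l + n + 1) * a * b)) * a ^ n := by
    rw [mul_smul_comm, smul_mul_assoc]
  push_cast at hB
  rw [show (l : ℤ) + n + 1 + 1 = l + n + 2 by ring,
    show 1 - 4 * ((l : ℤ) + n + 1) = -3 - 4 * l - 4 * n by ring] at hB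
  rw [hL, mul_assoc _ (a ^ _) b, hA, mul_add, mul_sub, mul_smul_comm, mul_smul_comm,
    mul_smul_comm, r1, r2, r3, smul_add, smul_sub, smul_comm _ (qint (n + 1)), hX, hB]
  simp only [mul_add, mul_sub, add_mul, sub_mul, mul_smul_comm, smul_mul_assoc, r4, r5, r6]
  simp only [brace, add_mul, smul_mul_assoc]
  have e := qint_add_mul_qint_add (l + 1) 1 n
  rw [qint_one, show (l : ℤ) + 1 + n = l + n + 1 by ring, add_comm 1 (n : ℤ),
    show (l : ℤ) + 1 + 1 + n = l + n + 2 by ring] at e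
  have e4 : tz (2 * n + 1 - 6 * n - 6) * qint n
      - tz (-3 - 4 * l - 4 * n + 6 * l) * qint (l + n + 1)
      = - (tz (2 * l - 2 * n - 3) * qint (l + 1)) := by
    rw [show (l : ℤ) + n + 1 = n + (l + 1) by ring, ← tz_neg_mul_qint_add,
      mul_add (tz _) (_ * qint n), ← mul_assoc, ← mul_assoc, ← tz_add, ← tz_add]
    ring_nf
  have e5 : tz (-(2 * n + 1 - 6 * n - 6)) * qint n
      - tz (-(-3 - 4 * l - 4 * n + 6 * l)) * qint (l + n + 1)
      = - (tz (-(2 * l - 2 * n - 3)) * qint (l + 1)) := by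
    rw [show (l : ℤ) + n + 1 = n + (l + 1) by ring, ← tz_mul_qint_add,
      mul_add (tz _) (_ * qint n), ← mul_assoc, ← mul_assoc, ← tz_add, ← tz_add]
    ring_nf
  match_scalars
  · linear_combination e
  · ring
  · linear_combination qint (n + 1) * qint (l + n + 2) * e4
  · linear_combination qint (n + 1) * qint (l + n + 2) * e5

/-- The identity in terms of divided powers. -/
theorem dp_mul_dp_mul_dp_mul {a b k k' : A} (hk : Commute k k')
    (h : a * k = tz 6 • (k * a)) (h' : a * k' = tz (-6) • (k' * a))
    (g : b * k = tz (-6) • (k * b)) (g' : b * k' = tz 6 • (k' * b))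
    (hS : a ^ 2 * b - qint 2 • (a * b * a) + b * a ^ 2 = qint 2 • (brace k k' 3 * a))
    (hT : b ^ 2 * a - qint 2 • (b * a * b) + a * b ^ 2 = qint 2 • (brace k' k 3 * b))
    (t l : ℕ) :
    (dp b (t : ℤ) * dp a ((l : ℤ) + t) * dp b (l : ℤ)) * b
      = qint ((l : ℤ) + 1) •
          (dp a (l : ℤ) * dp b ((l : ℤ) + t + 1) * dp a (t : ℤ)
            + dp a ((l : ℤ) + 1) * dp b ((l : ℤ) + t + 1) * dp a ((t : ℤ) - 1)
            - brace k k' (2 * (l : ℤ) - 2 * (t : ℤ) - 1) *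
                (dp a (l : ℤ) * dp b ((l : ℤ) + t) * dp a ((t : ℤ) - 1))) := by
  cases t with
  | zero =>
    have h0 : dp a (((0 : ℕ) : ℤ) - 1) = 0 := by simp [dp]
    rw [h0]
    simp only [Nat.cast_zero, add_zero, mul_zero, sub_zero]
    have hl := qint_natCast_add_one_ne_zero l
    rw [show dp b ((l : ℤ) + 1) = dp b (l + 1 : ℕ) by push_cast; rfl,
      show (0 : ℤ) = (0 : ℕ) from rfl]
    simp only [dp_natCast, qfact, Finset.range_zero, Finset.prod_empty, inv_one,
      one_smul, pow_zero, one_mul, mul_one, smul_mul_assoc, mul_smul_comm, smul_smul, pow_succ,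
      mul_assoc]
    congr 1
    rw [Finset.prod_range_succ]
    field_simp
  | succ n =>
    have hm := pow_mul_pow_mul_pow_mul hk h h' g g' hS hT n l
    have hl := qint_natCast_add_one_ne_zero l
    have hn := qint_natCast_add_one_ne_zero n
    have hm1 : qint ((l : ℤ) + n + 2) ≠ 0 := by
      have := qint_natCast_add_one_ne_zero (l + n + 1)
      push_cast at this
      rwa [show (l : ℤ) + n + 1 + 1 = l + n + 2 by ring] at this
    rw [show (l : ℤ) + (n + 1 : ℕ) + 1 = (l + n + 2 : ℕ) by push_cast; ring,
      show ((n + 1 : ℕ) : ℤ) - 1 = (n : ℕ) by push_cast; ring,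
      show (l : ℤ) + (n + 1 : ℕ) = (l + n + 1 : ℕ) by push_cast; ring,
      show 2 * (l : ℤ) - 2 * (n + 1 : ℕ) - 1 = 2 * l - 2 * n - 3 by push_cast; ring,
      show dp a ((l : ℤ) + 1) = dp a (l + 1 : ℕ) by push_cast; rfl]
    simp only [dp_natCast, smul_mul_assoc, mul_smul_comm, smul_smul]
    have hX := (eq_inv_smul_iff₀ hm1).mpr hm
    rw [hX, qfact_succ (l + n + 1), qfact_succ n, qfact_succ l]
    push_cast
    rw [show (l : ℤ) + n + 1 + 1 = l + n + 2 by ring]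
    have := qfact_ne_zero n
    have := qfact_ne_zero l
    have := qfact_ne_zero (l + n + 1)
    match_scalars
    · field_simp
    · field_simp
    · field_simp

end UiAIII

/-- Identity (4.10) of the paper: for all `t, l ≥ 0`,
`(B₂^{(t)}B₁^{(l+t)}B₂^{(l)})·B₂ = [l+1]·( B₁^{(l)}B₂^{(l+t+1)}B₁^{(t)}
   + B₁^{(l+1)}B₂^{(l+t+1)}B₁^{(t−1)} − {k₁; l−t−1/2}·B₁^{(l)}B₂^{(l+t)}B₁^{(t−1)} )`,
in any algebra with elements satisfying the defining relations of the quasi-split iquantum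
group Uı of type AIII for sl₃ with parameters ς₁ = ς₂ = −q^{1/2}. -/
theorem statement4 (A : Type*) [Ring A] [Algebra K A]
    (B1 B2 k1 k1' : A)
    (hk : k1 * k1' = 1) (hk' : k1' * k1 = 1)
    (hkB1 : k1 * B1 = tz (-6) • (B1 * k1))
    (hkB2 : k1 * B2 = tz 6 • (B2 * k1))
    (hS1 : B1 ^ 2 * B2 - qint 2 • (B1 * B2 * B1) + B2 * B1 ^ 2
        = qint 2 • (B1 * (tz (-3) • k1 + tz 3 • k1')))
    (hS2 : B2 ^ 2 * B1 - qint 2 • (B2 * B1 * B2) + B1 * B2 ^ 2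
        = qint 2 • (B2 * (tz 3 • k1 + tz (-3) • k1')))
    (t l : ℕ) :
    (dp B2 (t : ℤ) * dp B1 ((l : ℤ) + t) * dp B2 (l : ℤ)) * B2
      = qint ((l : ℤ) + 1) •
          (dp B1 (l : ℤ) * dp B2 ((l : ℤ) + t + 1) * dp B1 (t : ℤ)
            + dp B1 ((l : ℤ) + 1) * dp B2 ((l : ℤ) + t + 1) * dp B1 ((t : ℤ) - 1)
            - brace k1 k1' (2 * (l : ℤ) - 2 * (t : ℤ) - 1) *
                (dp B1 (l : ℤ) * dp B2 ((l : ℤ) + t) * dp B1 ((t : ℤ) - 1))) := by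
  have hkc : Commute k1 k1' := hk.trans hk'.symm
  have h := mul_eq_of_mul hkB1
  have g := mul_eq_of_mul hkB2
  have h' := mul_eq_of_mul (mul_inv_of_mul hk hk' hkB1)
  have g' := mul_eq_of_mul (mul_inv_of_mul hk hk' hkB2)
  rw [neg_neg] at h g'
  have hS : B1 ^ 2 * B2 - qint 2 • (B1 * B2 * B1) + B2 * B1 ^ 2
      = qint 2 • (brace k1 k1' 3 * B1) := by
    have e : B1 * (tz (-3) • k1 + tz 3 • k1') = brace k1 k1' 3 * B1 := by
      simp only [brace, mul_add, add_mul, mul_smul_comm, smul_mul_assoc, h, h', smul_smul,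
        ← tz_add]
      rfl
    rw [hS1, e]
  have hT : B2 ^ 2 * B1 - qint 2 • (B2 * B1 * B2) + B1 * B2 ^ 2
      = qint 2 • (brace k1' k1 3 * B2) := by
    have e : B2 * (tz 3 • k1 + tz (-3) • k1') = brace k1' k1 3 * B2 := by
      simp only [brace, mul_add, add_mul, mul_smul_comm, smul_mul_assoc, g, g', smul_smul,
        ← tz_add]
      exact add_comm _ _
    rw [hS2, e]
  exact dp_mul_dp_mul_dp_mul hkc h h' g g' hS hT t l
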